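/- Let N ≥ 1 and let u : ℝ^N → ℝ be Lebesgue integrable and radial, i.e. u(x) = v(‖x‖) for some v : [0,∞) → ℝ. Define μ(u)(x) := (1/|B₁|)∫_{B₁(x)} |u(y)| dy, ũ(x) := max( μ(u)(x) − (1/2)·sup_{z∈ℝ^N} μ(u)(z), 0 ), and, whenever 0 < ∫ũ < ∞ and ∫‖x‖·ũ(x) dx < ∞, the barycenter β(u) := (∫ x·ũ(x) dx)/(∫ ũ(x) dx) ∈ ℝ^N. Assume 0 < ∫ũ < ∞ and ∫‖x‖·ũ(x) dx < ∞. Then β(u) = 0. -/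

import Mathlib

open MeasureTheory

/-- Local average `μ(u)(x) = (1/|B₁|)∫_{B₁(x)} |u|`. -/
noncomputable def localAvg (N : ℕ) (u : EuclideanSpace ℝ (Fin N) → ℝ)
    (x : EuclideanSpace ℝ (Fin N)) : ℝ :=
  (volume (Metric.ball (0 : EuclideanSpace ℝ (Fin N)) 1)).toReal⁻¹ *
    ∫ y in Metric.ball x 1, |u y|

/-- The truncation `ũ(x) = (μ(u)(x) - (1/2)·sup μ(u))⁺`. -/
noncomputable def baryTrunc (N : ℕ) (u : EuclideanSpace ℝ (Fin N) → ℝ)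
    (x : EuclideanSpace ℝ (Fin N)) : ℝ :=
  max (localAvg N u x - (1 / 2) * ⨆ z, localAvg N u z) 0

/-- The barycenter `β(u) = (∫ x·ũ(x) dx)/(∫ ũ)`. -/
noncomputable def barycenter (N : ℕ) (u : EuclideanSpace ℝ (Fin N) → ℝ) :
    EuclideanSpace ℝ (Fin N) :=
  (∫ x, baryTrunc N u x)⁻¹ • ∫ x, baryTrunc N u x • x

theorem localAvg_neg_aux (N : ℕ) (u : EuclideanSpace ℝ (Fin N) → ℝ)
    (hu : ∀ x, u (-x) = u x) (x : EuclideanSpace ℝ (Fin N)) :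
    localAvg N u (-x) = localAvg N u x := by
  unfold localAvg
  congr 1
  rw [← integral_indicator Metric.isOpen_ball.measurableSet,
    ← integral_indicator Metric.isOpen_ball.measurableSet,
    ← integral_neg_eq_self]
  congr 1
  ext y
  have h : (-y ∈ Metric.ball (-x) 1) ↔ y ∈ Metric.ball x 1 := by
    simp [Metric.mem_ball, dist_neg_neg]
  by_cases hy : y ∈ Metric.ball x 1
  · rw [Set.indicator_of_mem hy, Set.indicator_of_mem (h.2 hy), hu]
  · rw [Set.indicator_of_notMem hy, Set.indicator_of_notMem (fun h' => hy (h.1 h'))]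

/-- The barycenter of a radial integrable function is the origin. -/
theorem barycenter_radial_eq_zero (N : ℕ) (hN : 1 ≤ N)
    (u : EuclideanSpace ℝ (Fin N) → ℝ) (hu : Integrable u)
    (v : ℝ → ℝ) (hrad : ∀ x, u x = v ‖x‖)
    (h1 : Integrable (baryTrunc N u))
    (h2 : 0 < ∫ x, baryTrunc N u x)
    (h3 : Integrable (fun x => ‖x‖ * baryTrunc N u x)) :
    barycenter N u = 0 := by
  have hloc := localAvg_neg_aux N u (fun x => by rw [hrad, hrad, norm_neg])
  have ht : ∀ x, baryTrunc N u (-x) = baryTrunc N u x := fun x => by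
    unfold baryTrunc
    rw [hloc]
  have key : ∫ x, baryTrunc N u x • x = 0 := by
    have h := integral_neg_eq_self (fun x => baryTrunc N u x • x) volume
    simp only [ht, smul_neg, integral_neg] at h
    have h4 := eq_neg_iff_add_eq_zero.1 h.symm
    rw [← two_smul ℝ] at h4
    exact (smul_eq_zero.1 h4).resolve_left two_ne_zero
  unfold barycenter
  rw [key, smul_zero]
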